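/- Let d be a positive integer, D a non-negative integer, and s ∈ ℂ with Re(s) > d+2. Then F_q^{(3)}(D;s;d) = Σ_{t>D} (q^{(s−d−2)t}/[t]_q^{s−d−1}) · Σ_{0<n₀≤n₁≤⋯≤n_d≤t, n₀<t−D} q^{n₀+n₁+⋯+n_d}/([n₀]_q[n₁]_q⋯[n_d]_q), all series converging absolutely. -/

import Mathlib

open Complex

/-- The `q`-analogue `[n]_q = (1 - q^n)/(1 - q)` of a natural number `n`. -/
noncomputable def qnum (q : ℝ) (n : ℕ) : ℝ := (1 - q ^ n) / (1 - q)

/-- The product `∏_i q^{n_i}/[n_i]_q` over a chain `n₁ ≤ ⋯ ≤ n_d`. -/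
noncomputable def chainProd (q : ℝ) {d : ℕ} (n : Fin d → ℕ) : ℂ :=
  ∏ i, ((q : ℂ) ^ (n i) / (qnum q (n i) : ℂ))

/-- The index set for `F_q^{(0)}(D;s;d)`: pairs of `m > D` and chains
`m − D ≤ n₁ ≤ ⋯ ≤ n_d ≤ m`. -/
def F0Idx (D d : ℕ) : Type :=
  {p : ℕ × (Fin d → ℕ) // D < p.1 ∧ Monotone p.2 ∧ ∀ i, p.1 - D ≤ p.2 i ∧ p.2 i ≤ p.1}

/-- The general term of the series `F_q^{(0)}(D;s;d)`. -/
noncomputable def F0term (q : ℝ) (d : ℕ) (s : ℂ) (p : ℕ × (Fin d → ℕ)) : ℂ :=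
  ((q : ℂ) ^ ((s - (d : ℂ) - 1) * (p.1 : ℂ)) / (qnum q p.1 : ℂ) ^ (s - (d : ℂ))) *
    chainProd q p.2

/-- The index set for `F_q^{(1)}, F_q^{(2)}, F_q^{(3)}`: triples of `D < t < m` and chains
`m − t ≤ n₁ ≤ ⋯ ≤ n_d ≤ m`. -/
def FIdx (D d : ℕ) : Type :=
  {p : ℕ × ℕ × (Fin d → ℕ) // D < p.1 ∧ p.1 < p.2.1 ∧ Monotone p.2.2 ∧
    ∀ i, p.2.1 - p.1 ≤ p.2.2 i ∧ p.2.2 i ≤ p.2.1}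

/-- The general term of the series `F_q^{(1)}(D;s;d)`. -/
noncomputable def F1term (q : ℝ) (d : ℕ) (s : ℂ) (p : ℕ × ℕ × (Fin d → ℕ)) : ℂ :=
  ((q : ℂ) ^ ((s - (d : ℂ) - 2) * (p.1 : ℂ)) * (q : ℂ) ^ (p.2.1 - p.1) /
      ((qnum q p.1 : ℂ) ^ (s - (d : ℂ) - 1) * (qnum q (p.2.1 - p.1) : ℂ))) *
    chainProd q p.2.2

/-- The general term of the series `F_q^{(2)}(D;s;d)`. -/
noncomputable def F2term (q : ℝ) (d : ℕ) (s : ℂ) (p : ℕ × ℕ × (Fin d → ℕ)) : ℂ :=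
  ((q : ℂ) ^ ((s - (d : ℂ) - 2) * (p.2.1 : ℂ)) * (q : ℂ) ^ (p.2.1) /
      ((qnum q p.1 : ℂ) ^ (s - (d : ℂ) - 1) * (qnum q p.2.1 : ℂ))) *
    chainProd q p.2.2

/-- The general term of the series `F_q^{(3)}(D;s;d)`. -/
noncomputable def F3term (q : ℝ) (d : ℕ) (s : ℂ) (p : ℕ × ℕ × (Fin d → ℕ)) : ℂ :=
  ((q : ℂ) ^ ((s - (d : ℂ) - 2) * (p.2.1 : ℂ)) * (q : ℂ) ^ (p.2.1 - p.1) /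
      ((qnum q p.2.1 : ℂ) ^ (s - (d : ℂ) - 1) * (qnum q (p.2.1 - p.1) : ℂ))) *
    chainProd q p.2.2

/-- The index set of the inner series in the rewriting of `F_q^{(3)}(D;s;d)`:
chains `0 < n₀ ≤ n₁ ≤ ⋯ ≤ n_d ≤ t` with `n₀ < t − D`. -/
def F3InnerIdx (D t d : ℕ) : Type :=
  {n : Fin (d + 1) → ℕ // Monotone n ∧ 0 < n 0 ∧ n (Fin.last d) ≤ t ∧ n 0 < t - D}

theorem one_le_qnum {q : ℝ} (hq0 : 0 < q) (hq1 : q < 1) {n : ℕ} (hn : n ≠ 0) :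
    1 ≤ qnum q n := by
  rw [qnum, one_le_div (by linarith)]
  linarith [pow_le_of_le_one hq0.le hq1.le hn]

theorem norm_chainProd_le_one {q : ℝ} (hq0 : 0 < q) (hq1 : q < 1) {d : ℕ} (n : Fin d → ℕ) :
    ‖chainProd q n‖ ≤ 1 := by
  rw [chainProd, norm_prod]
  refine Finset.prod_le_one (fun _ _ => norm_nonneg _) fun i _ => ?_
  rcases eq_or_ne (n i) 0 with h | h
  · simp [h, qnum]
  · have h1 := one_le_qnum hq0 hq1 h
    rw [norm_div, norm_pow, Complex.norm_real, Complex.norm_real, Real.norm_of_nonneg hq0.le,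
      Real.norm_of_nonneg (by linarith)]
    exact div_le_one_of_le₀ ((pow_le_one₀ hq0.le hq1.le).trans h1) (by linarith)

theorem chainProd_cons (q : ℝ) {d : ℕ} (k : ℕ) (n : Fin d → ℕ) :
    chainProd q (Fin.cons k n : Fin (d + 1) → ℕ) =
      (q : ℂ) ^ k / (qnum q k : ℂ) * chainProd q n := by
  rw [chainProd, Fin.prod_univ_succ, Fin.cons_zero]
  simp only [Fin.cons_succ, chainProd]

/-- The coefficient `q^{(s−d−2)t}/[t]_q^{s−d−1}` of the outer series. -/
noncomputable def outerCoeff (q : ℝ) (d : ℕ) (s : ℂ) (t : ℕ) : ℂ :=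
  (q : ℂ) ^ ((s - (d : ℂ) - 2) * (t : ℂ)) / (qnum q t : ℂ) ^ (s - (d : ℂ) - 1)

theorem norm_outerCoeff_le {q : ℝ} (hq0 : 0 < q) (hq1 : q < 1) {d : ℕ} {s : ℂ}
    (hs : (d : ℝ) + 2 < s.re) {t : ℕ} (ht : t ≠ 0) :
    ‖outerCoeff q d s t‖ ≤ (q ^ (s.re - d - 2)) ^ t := by
  have h1 := one_le_qnum hq0 hq1 ht
  rw [outerCoeff, norm_div, Complex.norm_cpow_eq_rpow_re_of_pos hq0,
    Complex.norm_cpow_eq_rpow_re_of_pos (by linarith)]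
  have hre : ((s - (d : ℂ) - 2) * (t : ℂ)).re = (s.re - d - 2) * t := by simp
  rw [hre, Real.rpow_mul_natCast hq0.le]
  refine div_le_self (by positivity) (Real.one_le_rpow h1 ?_)
  simp only [sub_re, natCast_re, one_re]
  linarith

/-- A chain `n₀ ≤ ⋯ ≤ n_d ≤ t` as a function into `{0, …, t}`. -/
def F3InnerIdx.toFin {D t d : ℕ} (n : F3InnerIdx D t d) : Fin (d + 1) → Fin (t + 1) :=
  fun i => ⟨n.1 i, Nat.lt_succ_of_le ((n.2.1 (Fin.le_last i)).trans n.2.2.2.1)⟩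

theorem F3InnerIdx.toFin_injective {D t d : ℕ} :
    Function.Injective (F3InnerIdx.toFin : F3InnerIdx D t d → _) := fun _ _ h =>
  Subtype.ext <| funext fun i => congrArg Fin.val (congrFun h i)

instance {D t d : ℕ} : Finite (F3InnerIdx D t d) :=
  Finite.of_injective _ F3InnerIdx.toFin_injective

theorem F3InnerIdx.card_le (D t d : ℕ) : Nat.card (F3InnerIdx D t d) ≤ (t + 1) ^ (d + 1) := by
  simpa using Nat.card_le_card_of_injective _ (F3InnerIdx.toFin_injective (D := D) (t := t) (d := d))

/-- The substitution `n₀ = m − t` identifying the index set of `F_q^{(3)}(D;s;d)` with that of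
the iterated series. -/
def FIdx.equivSigma {D d : ℕ} (hd : 1 ≤ d) :
    FIdx D d ≃ Σ t : {t : ℕ // D < t}, F3InnerIdx D t.1 d where
  toFun p := ⟨⟨p.1.2.1, p.2.1.trans p.2.2.1⟩,
    ⟨Fin.cons (p.1.2.1 - p.1.1) p.1.2.2, by
      obtain ⟨⟨t, m, n⟩, h1, h2, h3, h4⟩ := p
      dsimp only at h1 h2 h3 h4 ⊢
      refine ⟨?_, ?_, ?_, ?_⟩
      · intro i j hij
        induction i using Fin.cases with
        | zero =>
          induction j using Fin.cases with
          | zero => exact le_rfl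
          | succ j => exact (h4 j).1
        | succ i =>
          induction j using Fin.cases with
          | zero => exact absurd hij (by simp)
          | succ j => exact h3 (Fin.succ_le_succ_iff.1 hij)
      · rw [Fin.cons_zero]
        omega
      · obtain ⟨e, rfl⟩ : ∃ e, d = e + 1 := ⟨d - 1, by omega⟩
        rw [← Fin.succ_last, Fin.cons_succ]
        exact (h4 _).2
      · rw [Fin.cons_zero]
        omega⟩⟩
  invFun x := ⟨(x.1.1 - x.2.1 0, x.1.1, Fin.tail x.2.1), by
    obtain ⟨⟨t, ht⟩, n, h1, h2, h3, h4⟩ := x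
    dsimp only at h1 h2 h3 h4 ⊢
    refine ⟨by omega, by omega, fun i j hij => h1 (Fin.succ_le_succ_iff.2 hij), fun i => ⟨?_, ?_⟩⟩
    · have := h1 (Fin.zero_le i.succ)
      simp only [Fin.tail]
      omega
    · exact (h1 (Fin.le_last _)).trans h3⟩
  left_inv p := by
    obtain ⟨⟨t, m, n⟩, h1, h2, h3, h4⟩ := p
    refine Subtype.ext (Prod.ext ?_ (Prod.ext rfl ?_))
    · dsimp only at h2 ⊢
      rw [Fin.cons_zero]
      omega
    · simp
  right_inv x := by
    obtain ⟨⟨t, ht⟩, n, h1, h2, h3, h4⟩ := x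
    refine Sigma.ext rfl (heq_of_eq (Subtype.ext ?_))
    dsimp only at h1 h2 h3 h4 ⊢
    have h : t - (t - n 0) = n 0 := by omega
    simp only [h]
    exact Fin.cons_self_tail n

theorem F3term_eq (q : ℝ) {D d : ℕ} (hd : 1 ≤ d) (s : ℂ) (p : FIdx D d) :
    F3term q d s p.1 = outerCoeff q d s (FIdx.equivSigma hd p).1.1 *
      chainProd q (FIdx.equivSigma hd p).2.1 := by
  change _ = outerCoeff q d s p.1.2.1 *
    chainProd q (Fin.cons (p.1.2.1 - p.1.1) p.1.2.2 : Fin (d + 1) → ℕ)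
  rw [chainProd_cons, F3term, outerCoeff, mul_div_mul_comm, mul_assoc]

theorem summable_outerCoeff_mul_chainProd {q : ℝ} (hq0 : 0 < q) (hq1 : q < 1) (d D : ℕ) {s : ℂ}
    (hs : (d : ℝ) + 2 < s.re) :
    Summable (fun x : Σ t : {t : ℕ // D < t}, F3InnerIdx D t.1 d =>
      outerCoeff q d s x.1.1 * chainProd q x.2.1) := by
  set r : ℝ := q ^ (s.re - d - 2)
  have hr0 : 0 < r := Real.rpow_pos_of_pos hq0 _
  have hr1 : r < 1 := Real.rpow_lt_one hq0.le hq1 (by linarith)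
  have hgeom : Summable (fun t : ℕ => ((t + 1 : ℕ) : ℝ) ^ (d + 1) * r ^ t) := by
    have h : Summable (fun t : ℕ => (t : ℝ) ^ (d + 1) * r ^ t) :=
      summable_pow_mul_geometric_of_norm_lt_one (d + 1) (by rwa [Real.norm_of_nonneg hr0.le])
    refine (((summable_nat_add_iff 1).2 h).mul_right r⁻¹).congr fun t => ?_
    rw [pow_succ r t]
    field_simp
  refine Summable.of_norm_bounded (g := fun x => r ^ x.1.1) ?_ fun x => ?_
  · refine (summable_sigma_of_nonneg fun x => by positivity).2 ⟨fun t => Summable.of_finite, ?_⟩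
    refine Summable.of_nonneg_of_le (fun t => tsum_nonneg fun _ => by positivity) (fun t => ?_)
      (hgeom.comp_injective Subtype.val_injective)
    dsimp only [Function.comp_apply]
    rw [tsum_const, nsmul_eq_mul]
    refine mul_le_mul_of_nonneg_right ?_ (by positivity)
    exact_mod_cast F3InnerIdx.card_le D t.1 d
  · rw [norm_mul]
    exact (mul_le_of_le_one_right (norm_nonneg _) (norm_chainProd_le_one hq0 hq1 _)).trans
      (norm_outerCoeff_le hq0 hq1 hs (Nat.ne_zero_of_lt x.1.2))

/-- For `Re(s) > d + 2`,
`F_q^{(3)}(D;s;d) = Σ_{t>D} (q^{(s−d−2)t}/[t]_q^{s−d−1}) Σ_{0<n₀≤⋯≤n_d≤t, n₀<t−D}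
q^{n₀+⋯+n_d}/([n₀]_q⋯[n_d]_q)`, all series converging absolutely. -/
theorem F3_rewriting (q : ℝ) (hq0 : 0 < q) (hq1 : q < 1)
    (d D : ℕ) (hd : 1 ≤ d) (s : ℂ) (hs : (d : ℝ) + 2 < s.re) :
    Summable (fun p : FIdx D d => F3term q d s p.1) ∧
    (∀ t : ℕ, D < t → Summable (fun n : F3InnerIdx D t d => chainProd q n.1)) ∧
    Summable (fun t : {t : ℕ // D < t} =>
      ((q : ℂ) ^ ((s - (d : ℂ) - 2) * (t.1 : ℂ)) / (qnum q t.1 : ℂ) ^ (s - (d : ℂ) - 1)) *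
        ∑' n : F3InnerIdx D t.1 d, chainProd q n.1) ∧
    ∑' p : FIdx D d, F3term q d s p.1 =
      ∑' t : {t : ℕ // D < t},
        ((q : ℂ) ^ ((s - (d : ℂ) - 2) * (t.1 : ℂ)) / (qnum q t.1 : ℂ) ^ (s - (d : ℂ) - 1)) *
          ∑' n : F3InnerIdx D t.1 d, chainProd q n.1 := by
  have hsum := summable_outerCoeff_mul_chainProd hq0 hq1 d D hs
  have hF : (fun p : FIdx D d => F3term q d s p.1) =
      (fun x : Σ t : {t : ℕ // D < t}, F3InnerIdx D t.1 d =>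
        outerCoeff q d s x.1.1 * chainProd q x.2.1) ∘ FIdx.equivSigma hd :=
    funext fun p => F3term_eq q hd s p
  have hinner (t : {t : ℕ // D < t}) :
      ∑' n : F3InnerIdx D t.1 d, outerCoeff q d s t.1 * chainProd q n.1 =
        outerCoeff q d s t.1 * ∑' n : F3InnerIdx D t.1 d, chainProd q n.1 := tsum_mul_left
  refine ⟨?_, fun t _ => Summable.of_finite, ?_, ?_⟩
  · rw [hF]
    exact (FIdx.equivSigma hd).summable_iff.2 hsum
  · exact hsum.sigma.congr hinner
  · rw [hF]
    exact ((FIdx.equivSigma hd).tsum_eq (fun x : Σ t : {t : ℕ // D < t}, F3InnerIdx D t.1 d =>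
      outerCoeff q d s x.1.1 * chainProd q x.2.1)).trans (hsum.tsum_sigma.trans (tsum_congr hinner))
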